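/- arXiv:1602.03231 — 2 statements merged into one kernel-verified Lean document; each statement's English description precedes it below -/
import Mathlib

section
/- Let v = v₁⋯v_m be a nonempty word over A = {a,b} and write w = ψ(v) = w₁⋯w_k with k = |ψ(v)|. Then ext(v) = card{ π(ψ(v₁⋯v_i)) : 1 ≤ i ≤ m } = card{ π(w₁⋯w_i) : 1 ≤ i ≤ k }; that is, the number of maximal blocks of v equals the number of distinct minimal periods among the nonempty prefixes of ψ(v). -/
namespace Chri

/-- Length of the longest palindromic suffix of `w`. -/
def lpsLen (w : List Bool) : ℕ :=
  ((List.range (w.length + 1)).filter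
    (fun l => w.drop (w.length - l) == (w.drop (w.length - l)).reverse)).foldr max 0

/-- Right palindromic closure: the shortest palindrome having `w` as a prefix. -/
def palClosure (w : List Bool) : List Bool :=
  w ++ (w.take (w.length - lpsLen w)).reverse

/-- The iterated palindromization map ψ. -/
def psi (v : List Bool) : List Bool :=
  v.foldl (fun w x => palClosure (w ++ [x])) []

/-- Apply a substitution (morphism of the free monoid) letter by letter. -/
def applyM (f : Bool → List Bool) (w : List Bool) : List Bool := (w.map f).flatten

/-- μ_x : x ↦ x, y ↦ xy (a = false, b = true). -/
def muL (x : Bool) : List Bool → List Bool :=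
  applyM (fun y => if y = x then [x] else [x, y])

/-- λ_a = μ_a; λ_b : a ↦ ab, b ↦ b. -/
def lamL : Bool → List Bool → List Bool
  | false => applyM (fun y => if y = false then [false] else [false, true])
  | true  => applyM (fun y => if y = true then [true] else [false, true])

/-- μ_{v₁⋯v_n} = μ_{v₁} ∘ ⋯ ∘ μ_{v_n}. -/
def muW : List Bool → List Bool → List Bool
  | [], w => w
  | x :: v, w => muL x (muW v w)

/-- λ_{v₁⋯v_n} = λ_{v₁} ∘ ⋯ ∘ λ_{v_n}. -/
def lamW : List Bool → List Bool → List Bool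
  | [], w => w
  | x :: v, w => lamL x (lamW v w)

/-- Christoffel words: the letters and the words aψ(v)b. -/
def IsChristoffel (w : List Bool) : Prop :=
  w = [false] ∨ w = [true] ∨ ∃ v, w = false :: (psi v ++ [true])

/-- A word is constant if it is a power of a single letter. -/
def IsConstant (v : List Bool) : Prop := ∃ x n, v = List.replicate n x

/-- ₊v : the longest proper suffix of v immediately preceded by the complement of
the first letter of v. -/
def plusV (v : List Bool) : List Bool :=
  (v.dropWhile (fun y => y == v.headD false)).tail

/-- v₊ : the longest proper prefix of v immediately followed by the complement of
the last letter of v. -/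
def vPlus (v : List Bool) : List Bool := (plusV v.reverse).reverse

/-- α₀: the length of the first maximal block of `v` (the index). -/
def blockLen (v : List Bool) : ℕ :=
  (v.takeWhile (fun y => y == v.headD false)).length

/-- The list of lengths of the maximal blocks of equal letters of `v`
(the integral representation (α₀, …, α_n)). -/
def blockLens : List Bool → List ℕ
  | [] => []
  | [_] => [1]
  | x :: y :: v =>
    if x = y then
      match blockLens (y :: v) with
      | [] => [1]
      | n :: ns => (n + 1) :: ns
    else 1 :: blockLens (y :: v)

/-- ext(v) = number of maximal blocks of v. -/
def ext (v : List Bool) : ℕ := (blockLens v).length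

/-- π(w): the minimal period of `w` (with π(ε) = 1). -/
noncomputable def minPeriod (w : List Bool) : ℕ :=
  sInf {p | 0 < p ∧ ∀ i, i + p < w.length → w.getD i false = w.getD (i + p) false}

/-- φ_k : a ↦ a^{k+1} b, b ↦ a^k b. -/
def phi (k : ℕ) : List Bool → List Bool :=
  applyM (fun y => if y = false then List.replicate (k + 1) false ++ [true]
                   else List.replicate k false ++ [true])

/-- φ̂_k : a ↦ a b^k, b ↦ a b^{k+1}. -/
def phiHat (k : ℕ) : List Bool → List Bool :=
  applyM (fun y => if y = false then false :: List.replicate k true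
                   else false :: List.replicate (k + 1) true)

attribute [local instance] Classical.propDecidable

/-- The derivative ∂w of a proper Christoffel word w = aψ(v)b of index k:
∂(ab) = a, and otherwise the preimage of w under φ_k (if v starts with a)
or φ̂_k (if v starts with b). -/
noncomputable def derivC (w : List Bool) : List Bool :=
  if w = [false, true] then [false]
  else if h : ∃ v, v ≠ [] ∧ w = false :: (psi v ++ [true]) then
    if h.choose.headD false = false then Function.invFun (phi (blockLen h.choose)) w
    else Function.invFun (phiHat (blockLen h.choose)) w
  else w

/-- The depth of a Christoffel word: the least d with ∂^d w a single letter. -/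
noncomputable def depth (w : List Bool) : ℕ :=
  sInf {d | derivC^[d] w = [false] ∨ derivC^[d] w = [true]}

/-- The height h(v): the least n ≥ 1 such that v_(n) is constant, where
v_(1) = v and v_(n+1) = ₊(v_(n)). -/
noncomputable def height (v : List Bool) : ℕ :=
  sInf {n | 0 < n ∧ IsConstant (plusV^[n - 1] v)}

/-- Helper computing δ_i from (α_{i-1}, δ_{i-1}) along the remaining exponents. -/
def ruleAux : ℕ → ℕ → List ℕ → List ℕ
  | _, _, [] => []
  | pa, pd, a :: rest =>
    let d := if 1 < a then 1 else if 1 < pa then 0 else 1 - pd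
    d :: ruleAux a d rest

/-- The sequence δ₀, δ₁, …, δ_n computed by the recursive rule (δ₀ = 1). -/
def ruleSeq : List ℕ → List ℕ
  | [] => []
  | a :: rest => 1 :: ruleAux a 1 rest

/-- δ(v) = Σ_{i=0}^n δ_i(v), where additionally δ_n(v) = 1; δ(ε) = 1. -/
def delta (v : List Bool) : ℕ := ((ruleSeq (blockLens v)).dropLast).sum + 1

/-- |u₁|: length of the longest prefix x₀⋯x_i of u with i < n and α₀ = ⋯ = α_i = 1
(and 0 if α₀ > 1 or n = 0). -/
def u1len (u : List Bool) : ℕ :=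
  min ((blockLens u).takeWhile (fun n => n == 1)).length ((blockLens u).length - 1)

/-- |u₂|: the symmetric notion for suffixes. -/
def u2len (u : List Bool) : ℕ := u1len u.reverse

/-- The sequence H: H(1) = 0, H(2n) = H(n), H(4n±1) = H(n)+1. -/
def H : ℕ → ℕ
  | 0 => 0
  | 1 => 0
  | n + 2 =>
    if (n + 2) % 2 = 0 then H ((n + 2) / 2)
    else if (n + 2) % 4 = 1 then H ((n + 2) / 4) + 1
    else H ((n + 3) / 4) + 1
decreasing_by all_goals omega

/-- ⟨w⟩: the word w read as an integer in base 2 (a = 0, b = 1). -/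
def wordVal (w : List Bool) : ℕ :=
  w.foldl (fun acc x => 2 * acc + (if x then 1 else 0)) 0

/-- Membership in X^*: w is a concatenation of words of X. -/
def InStar (X : Set (List Bool)) (w : List Bool) : Prop :=
  ∃ l : List (List Bool), (∀ u ∈ l, u ∈ X) ∧ w = l.flatten

/-- w ∈ x⁺. -/
def PowPos (x : Bool) (w : List Bool) : Prop := ∃ k, 0 < k ∧ w = List.replicate k x

/-- `p` is a (positive) period of `w`. -/
def IsPer (p : ℕ) (w : List Bool) : Prop :=
  0 < p ∧ ∀ i, i + p < w.length → w.getD i false = w.getD (i + p) false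

theorem isPer_length_add_one (w : List Bool) : IsPer (w.length + 1) w :=
  ⟨by omega, fun i h => by omega⟩

theorem isPer_minPeriod (w : List Bool) : IsPer (minPeriod w) w :=
  Nat.sInf_mem (s := {p | IsPer p w}) ⟨_, isPer_length_add_one w⟩

theorem minPeriod_le {p : ℕ} {w : List Bool} (h : IsPer p w) : minPeriod w ≤ p :=
  Nat.sInf_le (s := {p | IsPer p w}) h

theorem getD_append_left {u : List Bool} (t : List Bool) {i : ℕ} (h : i < u.length) :
    (u ++ t).getD i false = u.getD i false := by
  simp [List.getD_eq_getElem?_getD, List.getElem?_append_left h]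

theorem getD_append_singleton (u : List Bool) (x : Bool) :
    (u ++ [x]).getD u.length false = x := by
  simp [List.getD_eq_getElem?_getD]

theorem IsPer.of_prefix {p : ℕ} {u w : List Bool} (h : IsPer p w) (hu : u <+: w) :
    IsPer p u := by
  obtain ⟨t, rfl⟩ := hu
  refine ⟨h.1, fun i hi => ?_⟩
  have := h.2 i (by simp; omega)
  rwa [getD_append_left t (by omega), getD_append_left t hi] at this

theorem minPeriod_mono {u w : List Bool} (h : u <+: w) : minPeriod u ≤ minPeriod w :=
  minPeriod_le ((isPer_minPeriod w).of_prefix h)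

theorem getD_reflect {w : List Bool} (hw : w.reverse = w) {i j : ℕ}
    (h : i + j + 1 = w.length) : w.getD i false = w.getD j false := by
  conv_lhs => rw [← hw]
  rw [List.getD_eq_getElem?_getD, List.getD_eq_getElem?_getD,
    List.getElem?_reverse (by omega)]
  congr 3
  omega

theorem reverse_eq_of_getD {w : List Bool}
    (h : ∀ i j, i + j + 1 = w.length → w.getD i false = w.getD j false) :
    w.reverse = w := by
  refine List.ext_getElem (by simp) fun i h₁ h₂ => ?_
  have := h (w.length - 1 - i) i (by omega)
  rw [List.getD_eq_getElem _ _ (by omega), List.getD_eq_getElem _ _ h₂] at this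
  rw [List.getElem_reverse, this]

theorem le_foldr_max {l : List ℕ} {a : ℕ} (h : a ∈ l) : a ≤ l.foldr max 0 := by
  induction l with
  | nil => simp at h
  | cons b l ih =>
    rcases List.mem_cons.1 h with rfl | h
    · simp
    · simp [ih h]

theorem foldr_max_mem {l : List ℕ} (h : 0 ∈ l) : l.foldr max 0 ∈ l := by
  have key : ∀ l : List ℕ, l.foldr max 0 = 0 ∨ l.foldr max 0 ∈ l := by
    intro l
    induction l with
    | nil => simp
    | cons b l ih =>
      rcases max_choice b (l.foldr max 0) with hb | hb
      · exact Or.inr (by simp [hb])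
      · rw [List.foldr_cons, hb]
        exact ih.imp_right (List.mem_cons_of_mem b)
  rcases key l with h0 | h0
  · rwa [h0]
  · exact h0

theorem lpsLen_spec (w : List Bool) : lpsLen w ≤ w.length ∧
    (w.drop (w.length - lpsLen w)).reverse = w.drop (w.length - lpsLen w) := by
  have := foldr_max_mem (l := (List.range (w.length + 1)).filter
    (fun l => w.drop (w.length - l) == (w.drop (w.length - l)).reverse)) (by simp)
  rw [List.mem_filter, List.mem_range, beq_iff_eq] at this
  exact ⟨Nat.lt_succ_iff.1 this.1, this.2.symm⟩

theorem le_lpsLen {w : List Bool} {l : ℕ} (hl : l ≤ w.length)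
    (h : (w.drop (w.length - l)).reverse = w.drop (w.length - l)) : l ≤ lpsLen w := by
  refine le_foldr_max ?_
  rw [List.mem_filter, List.mem_range, beq_iff_eq]
  exact ⟨Nat.lt_succ_iff.2 hl, h.symm⟩

theorem prefix_palClosure (w : List Bool) : w <+: palClosure w := List.prefix_append _ _

theorem reverse_palClosure (w : List Bool) : (palClosure w).reverse = palClosure w := by
  have h := (lpsLen_spec w).2
  have h' := List.take_append_drop (w.length - lpsLen w) w
  unfold palClosure
  generalize w.take (w.length - lpsLen w) = s at h' ⊢
  generalize w.drop (w.length - lpsLen w) = q at h h'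
  simp [← h', h]

theorem length_palClosure (w : List Bool) :
    (palClosure w).length + lpsLen w = 2 * w.length := by
  have := (lpsLen_spec w).1
  simp [palClosure]
  omega

/-- A period of `wx`, for `w` a palindrome, yields a palindromic suffix of `wx`. -/
theorem IsPer.length_le_add_lpsLen {w : List Bool} (hw : w.reverse = w) {x : Bool} {p : ℕ}
    (hp : IsPer p (w ++ [x])) (hpw : p ≤ w.length) : w.length + 2 ≤ p + lpsLen (w ++ [x]) := by
  obtain ⟨hp0, hp⟩ := hp
  have hlen : (w ++ [x]).length = w.length + 1 := by simp
  have hrefl : ∀ i j, i + j + 1 = w.length →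
      (w ++ [x]).getD i false = (w ++ [x]).getD j false := fun i j hij => by
    rw [getD_append_left _ (by omega), getD_append_left _ (by omega), getD_reflect hw hij]
  suffices h : w.length + 2 - p ≤ lpsLen (w ++ [x]) by omega
  generalize w ++ [x] = u at *
  have hsymm : ∀ i j, i + j = w.length + p - 1 → j ≤ w.length → i < w.length →
      u.getD i false = u.getD j false := fun i j hij hj hi => by
    rw [hrefl i (j - p) (by omega), hp (j - p) (by omega)]
    congr 1
    omega
  refine le_lpsLen (by omega) (reverse_eq_of_getD fun i j hij => ?_)
  rw [List.length_drop] at hij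
  simp only [List.getD_eq_getElem?_getD, List.getElem?_drop]
  simp only [← List.getD_eq_getElem?_getD]
  by_cases hi : u.length - (w.length + 2 - p) + i < w.length
  · exact hsymm _ _ (by omega) (by omega) hi
  · by_cases hj : u.length - (w.length + 2 - p) + j < w.length
    · exact (hsymm _ _ (by omega) (by omega) hj).symm
    · congr 1
      omega

theorem one_le_lpsLen_append_singleton (w : List Bool) (x : Bool) :
    1 ≤ lpsLen (w ++ [x]) :=
  le_lpsLen (by simp) (by simp)

theorem isPer_of_prefix_of_reverse_eq {w z : List Bool} (hw : w.reverse = w)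
    (hz : z.reverse = z) (h : w <+: z) {r : ℕ} (hr : 0 < r) (hlen : z.length = w.length + r) :
    IsPer r z := by
  refine ⟨hr, fun i hi => ?_⟩
  obtain ⟨t, rfl⟩ := h
  rw [getD_append_left t (by omega), getD_reflect hw (j := w.length - 1 - i) (by omega),
    ← getD_append_left t (by omega), getD_reflect hz (j := i + r) (by omega)]

theorem minPeriod_palClosure_append_singleton {w : List Bool} (hw : w.reverse = w) (x : Bool) :
    minPeriod (palClosure (w ++ [x])) = minPeriod (w ++ [x]) ∧
      (palClosure (w ++ [x])).length = w.length + minPeriod (palClosure (w ++ [x])) := by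
  have h₁ := one_le_lpsLen_append_singleton w x
  have h₂ := (lpsLen_spec (w ++ [x])).1
  have h₃ := length_palClosure (w ++ [x])
  rw [List.length_append, List.length_singleton] at h₂ h₃
  have hper : IsPer (w.length + 2 - lpsLen (w ++ [x])) (palClosure (w ++ [x])) :=
    isPer_of_prefix_of_reverse_eq hw (reverse_palClosure _)
      ((List.prefix_append w [x]).trans (prefix_palClosure _)) (by omega) (by omega)
  have h₄ := minPeriod_le hper
  have h₅ := minPeriod_mono (prefix_palClosure (w ++ [x]))
  have h₆ : w.length + 2 ≤ minPeriod (w ++ [x]) + lpsLen (w ++ [x]) := by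
    by_cases hp : minPeriod (w ++ [x]) ≤ w.length
    · exact (isPer_minPeriod _).length_le_add_lpsLen hw hp
    · omega
  omega

theorem isPer_palClosure_append_singleton_iff {w : List Bool} (hw : w.reverse = w)
    (x y : Bool) :
    IsPer (minPeriod (palClosure (w ++ [x]))) (palClosure (w ++ [x]) ++ [y]) ↔ x = y := by
  have hlen := (minPeriod_palClosure_append_singleton hw x).2
  have hx : (palClosure (w ++ [x])).getD w.length false = x := by
    rw [palClosure, getD_append_left _ (by simp), getD_append_singleton]
  have hper := isPer_minPeriod (palClosure (w ++ [x]))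
  generalize palClosure (w ++ [x]) = z at *
  have hz := hper.1
  constructor
  · intro h
    have := h.2 w.length (by simp; omega)
    rwa [← hlen, getD_append_singleton, getD_append_left _ (by omega), hx] at this
  · rintro rfl
    refine ⟨hz, fun i hi => ?_⟩
    rw [List.length_append, List.length_singleton] at hi
    rw [getD_append_left _ (by omega)]
    rcases Nat.lt_succ_iff_lt_or_eq.1 hi with hi | hi
    · rw [getD_append_left _ hi, hper.2 i hi]
    · rw [hi, getD_append_singleton, ← hx]
      congr 1
      omega

theorem psi_append_singleton (v : List Bool) (x : Bool) :
    psi (v ++ [x]) = palClosure (psi v ++ [x]) := by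
  simp [psi]

theorem reverse_psi (v : List Bool) : (psi v).reverse = psi v := by
  induction v using List.reverseRecOn with
  | nil => rfl
  | append_singleton v x _ => rw [psi_append_singleton, reverse_palClosure]

theorem psi_append_prefix (v : List Bool) (x : Bool) : psi v ++ [x] <+: psi (v ++ [x]) := by
  rw [psi_append_singleton]
  exact prefix_palClosure _

theorem minPeriod_psi_append (v : List Bool) (x : Bool) :
    minPeriod (psi (v ++ [x])) = minPeriod (psi v ++ [x]) := by
  rw [psi_append_singleton]
  exact (minPeriod_palClosure_append_singleton (reverse_psi v) x).1

theorem minPeriod_psi_le_append (v : List Bool) (x : Bool) :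
    minPeriod (psi v) ≤ minPeriod (psi (v ++ [x])) :=
  minPeriod_mono ((List.prefix_append _ _).trans (psi_append_prefix v x))

theorem minPeriod_psi_append_self (v : List Bool) (x : Bool) :
    minPeriod (psi (v ++ [x] ++ [x])) = minPeriod (psi (v ++ [x])) := by
  refine le_antisymm ?_ (minPeriod_psi_le_append _ _)
  rw [minPeriod_psi_append, psi_append_singleton v]
  exact minPeriod_le ((isPer_palClosure_append_singleton_iff (reverse_psi v) x x).2 rfl)

theorem minPeriod_psi_lt_append (v : List Bool) {x y : Bool} (h : x ≠ y) :
    minPeriod (psi (v ++ [x])) < minPeriod (psi (v ++ [x] ++ [y])) := by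
  refine lt_of_le_of_ne (minPeriod_psi_le_append _ _) fun heq => h ?_
  rw [minPeriod_psi_append (v ++ [x]), psi_append_singleton v] at heq
  rw [← isPer_palClosure_append_singleton_iff (reverse_psi v) x y, heq]
  exact isPer_minPeriod _

theorem ext_cons_cons (x y : Bool) (v : List Bool) :
    ext (x :: y :: v) = ext (y :: v) + if x = y then 0 else 1 := by
  have hpos : blockLens (y :: v) ≠ [] := by
    cases v with
    | nil => simp [blockLens]
    | cons z v =>
      rw [blockLens]
      split_ifs
      · split <;> simp
      · simp
  rw [ext, ext, blockLens]
  split_ifs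
  · split
    · contradiction
    · simp [*]
  · simp

theorem ext_append_append (v : List Bool) (x y : Bool) :
    ext (v ++ [x] ++ [y]) = ext (v ++ [x]) + if x = y then 0 else 1 := by
  induction v with
  | nil => exact (ext_cons_cons x y []).trans (by simp [ext, blockLens])
  | cons z v ih =>
    cases v with
    | nil =>
      have h₁ := ext_cons_cons z x [y]
      have h₂ := ext_cons_cons z x []
      simp only [List.nil_append, List.cons_append] at *
      omega
    | cons t v =>
      have h₁ := ext_cons_cons z t (v ++ [x] ++ [y])
      have h₂ := ext_cons_cons z t (v ++ [x])
      simp only [List.cons_append] at *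
      omega

theorem image_Icc_take_append {α : Type*} (f : List Bool → ℕ) (v : List α)
    (g : List α → List Bool) (x : α) :
    (Finset.Icc 1 (v ++ [x]).length).image (fun i => f (g ((v ++ [x]).take i))) =
      insert (f (g (v ++ [x]))) ((Finset.Icc 1 v.length).image (fun i => f (g (v.take i)))) := by
  rw [List.length_append, List.length_singleton,
    ← Finset.insert_Icc_right_eq_Icc_add_one (by omega), Finset.image_insert]
  congr 1
  · rw [List.take_of_length_le (by simp)]
  · refine Finset.image_congr fun i hi => ?_
    have hi := (Finset.mem_Icc.1 (Finset.mem_coe.1 hi)).2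
    simp only [List.take_append_of_le_length hi]

theorem minPeriod_psi_take_le (v : List Bool) (i : ℕ) :
    minPeriod (psi (v.take i)) ≤ minPeriod (psi v) := by
  induction v using List.reverseRecOn with
  | nil => simp
  | append_singleton v x ih =>
    rcases le_or_gt i v.length with hi | hi
    · rw [List.take_append_of_le_length hi]
      exact ih.trans (minPeriod_psi_le_append v x)
    · rw [List.take_of_length_le (by simp; omega)]

theorem ext_eq_card_minPeriod_psi_take (v : List Bool) :
    ext v = ((Finset.Icc 1 v.length).image (fun i => minPeriod (psi (v.take i)))).card := by
  induction v using List.reverseRecOn with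
  | nil => simp [ext, blockLens]
  | append_singleton v y ih =>
    rw [image_Icc_take_append minPeriod v psi]
    rcases List.eq_nil_or_concat' v with rfl | ⟨v, x, rfl⟩
    · simp [ext, blockLens]
    · rw [ext_append_append, ih]
      by_cases hxy : x = y
      · subst hxy
        rw [Finset.insert_eq_of_mem, if_pos rfl, add_zero]
        rw [minPeriod_psi_append_self, image_Icc_take_append minPeriod v psi]
        exact Finset.mem_insert_self _ _
      · rw [Finset.card_insert_of_notMem, if_neg hxy]
        intro hmem
        obtain ⟨i, -, hi⟩ := Finset.mem_image.1 hmem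
        have h₁ := minPeriod_psi_take_le (v ++ [x]) i
        have h₂ := minPeriod_psi_lt_append v hxy
        omega

theorem image_minPeriod_take_psi (v : List Bool) :
    (Finset.Icc 1 (psi v).length).image (fun i => minPeriod ((psi v).take i)) =
      (Finset.Icc 1 v.length).image (fun i => minPeriod (psi (v.take i))) := by
  induction v using List.reverseRecOn with
  | nil => rfl
  | append_singleton v x ih =>
    rw [image_Icc_take_append minPeriod v psi, ← ih]
    have hper := minPeriod_psi_append v x
    obtain ⟨t, ht⟩ := psi_append_prefix v x
    have hlen := congrArg List.length ht
    simp only [List.length_append, List.length_singleton] at hlen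
    have hshort : ∀ i ≤ (psi v).length, (psi (v ++ [x])).take i = (psi v).take i :=
      fun i hi => by rw [← ht, List.append_assoc, List.take_append_of_le_length hi]
    ext p
    simp only [Finset.mem_insert, Finset.mem_image, Finset.mem_Icc]
    constructor
    · rintro ⟨i, ⟨hi₁, hi₂⟩, rfl⟩
      rcases le_or_gt i (psi v).length with hi | hi
      · exact Or.inr ⟨i, ⟨hi₁, hi⟩, by rw [hshort i hi]⟩
      · refine Or.inl (le_antisymm (minPeriod_mono (List.take_prefix _ _)) ?_)
        rw [hper]
        refine minPeriod_mono ?_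
        rw [List.prefix_take_iff]
        exact ⟨⟨t, ht⟩, by simp; omega⟩
    · rintro (rfl | ⟨i, ⟨hi₁, hi₂⟩, rfl⟩)
      · exact ⟨(psi (v ++ [x])).length, ⟨by omega, le_rfl⟩, by rw [List.take_length]⟩
      · exact ⟨i, ⟨hi₁, by omega⟩, by rw [hshort i hi₂]⟩

/-- ext(v) equals the number of distinct minimal periods of the
central words ψ(v₁⋯v_i), and also the number of distinct minimal periods of the
nonempty prefixes of ψ(v). -/
theorem ext_eq_card_minPeriods (v : List Bool) (hv : v ≠ []) :
    ext v = ((Finset.Icc 1 v.length).image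
        (fun i => minPeriod (psi (v.take i)))).card ∧
    ext v = ((Finset.Icc 1 (psi v).length).image
        (fun i => minPeriod ((psi v).take i))).card := by
  rw [image_minPeriod_take_psi]
  exact ⟨ext_eq_card_minPeriod_psi_take v, ext_eq_card_minPeriod_psi_take v⟩

end Chri
end

section
/- For all words w, v over A = {a,b}, a·ψ(wv)·b = λ_w(a·ψ(v)·b). -/
namespace Chri

attribute [local instance] Classical.propDecidable

/-! ### Right palindromic closure, read from the left -/

theorem foldr_max_zero_le {L : List ℕ} {n : ℕ} (h : ∀ l ∈ L, l ≤ n) : L.foldr max 0 ≤ n := by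
  induction L with
  | nil => simp
  | cons a L ih => simp_all

theorem foldr_max_append_singleton {L : List ℕ} {n : ℕ} (h : ∀ l ∈ L, l ≤ n) :
    (L ++ [n]).foldr max 0 = n := by
  induction L with
  | nil => simp
  | cons a L ih => simp_all

theorem lpsLen_le (w : List Bool) : lpsLen w ≤ w.length := by
  refine foldr_max_zero_le fun l hl => ?_
  simp only [List.mem_filter, List.mem_range] at hl
  omega

theorem filter_range_cons (c : Bool) (w : List Bool) :
    (List.range (w.length + 1)).filter (fun l => (c :: w).drop ((c :: w).length - l) ==
        ((c :: w).drop ((c :: w).length - l)).reverse) =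
      (List.range (w.length + 1)).filter (fun l => w.drop (w.length - l) ==
        (w.drop (w.length - l)).reverse) := by
  refine List.filter_congr fun l hl => ?_
  have hl : l ≤ w.length := by simpa [Nat.lt_succ_iff] using hl
  rw [List.length_cons, Nat.succ_sub hl, List.drop_succ_cons]

theorem lpsLen_of_palindrome {w : List Bool} (h : w.reverse = w) : lpsLen w = w.length := by
  unfold lpsLen
  rw [List.range_succ, List.filter_append]
  rw [List.filter_singleton]
  simp only [Nat.sub_self, List.drop_zero, h, beq_self_eq_true, cond_true]
  refine foldr_max_append_singleton fun l hl => ?_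
  simp only [List.mem_filter, List.mem_range] at hl
  omega

theorem lpsLen_cons_of_not_palindrome {c : Bool} {w : List Bool}
    (h : (c :: w).reverse ≠ c :: w) : lpsLen (c :: w) = lpsLen w := by
  have hb : (c :: w == (c :: w).reverse) = false := by simpa using fun e => h (by simpa using e.symm)
  unfold lpsLen
  rw [List.range_succ, List.filter_append, List.filter_singleton]
  rw [show List.range (c :: w).length = List.range (w.length + 1) from rfl, filter_range_cons]
  simp only [Nat.sub_self, List.drop_zero, hb, cond_false, List.append_nil]

theorem palClosure_of_palindrome {w : List Bool} (h : w.reverse = w) : palClosure w = w := by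
  simp [palClosure, lpsLen_of_palindrome h]

theorem palClosure_cons_of_not_palindrome {c : Bool} {w : List Bool}
    (h : (c :: w).reverse ≠ c :: w) : palClosure (c :: w) = c :: (palClosure w ++ [c]) := by
  rw [palClosure, lpsLen_cons_of_not_palindrome h, List.length_cons,
    Nat.succ_sub (lpsLen_le w)]
  simp [palClosure]

theorem cons_append_singleton_not_palindrome {c d : Bool} (h : c ≠ d) (w : List Bool) :
    (c :: (w ++ [d])).reverse ≠ c :: (w ++ [d]) := by
  simp [h.symm]

/-! ### The morphism `muL x` and palindromes -/

@[simp] theorem muL_nil (x : Bool) : muL x [] = [] := rfl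

@[simp] theorem muL_append (x : Bool) (u v : List Bool) :
    muL x (u ++ v) = muL x u ++ muL x v := by
  simp [muL, applyM]

theorem muL_cons_self (x : Bool) (w : List Bool) : muL x (x :: w) = x :: muL x w := by
  simp [muL, applyM]

theorem muL_cons_of_ne {x y : Bool} (h : y ≠ x) (w : List Bool) :
    muL x (y :: w) = x :: y :: muL x w := by
  simp [muL, applyM, h]

/-- The map `w ↦ μ_x(w) x`. -/
def muExt (x : Bool) (w : List Bool) : List Bool := muL x w ++ [x]

theorem muExt_cons_self (x : Bool) (w : List Bool) : muExt x (x :: w) = x :: muExt x w := by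
  simp [muExt, muL_cons_self]

theorem muExt_cons_of_ne {x y : Bool} (h : y ≠ x) (w : List Bool) :
    muExt x (y :: w) = x :: y :: muExt x w := by
  simp [muExt, muL_cons_of_ne h]

theorem muExt_append_self (x : Bool) (w : List Bool) : muExt x (w ++ [x]) = muExt x w ++ [x] := by
  simp [muExt, muL_cons_self]

theorem muExt_append_of_ne {x y : Bool} (h : y ≠ x) (w : List Bool) :
    muExt x (w ++ [y]) = muExt x w ++ [y, x] := by
  simp [muExt, muL_cons_of_ne h]

theorem muExt_reverse (x : Bool) (w : List Bool) :
    (muExt x w).reverse = muExt x w.reverse := by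
  induction w with
  | nil => simp [muExt]
  | cons c w ih =>
    rw [List.reverse_cons]
    by_cases h : c = x
    · subst h
      rw [muExt_append_self, muExt_cons_self, List.reverse_cons, ih]
    · rw [muExt_append_of_ne h, muExt_cons_of_ne h, List.reverse_cons, List.reverse_cons, ih]
      simp

theorem muExt_cons_ne_singleton (x c : Bool) (w : List Bool) : muExt x (c :: w) ≠ [x] := by
  by_cases h : c = x
  · subst h
    simp [muExt, muL_cons_self]
  · simp [muExt_cons_of_ne h]

theorem muExt_head (x : Bool) (w : List Bool) : ∃ t, muExt x w = x :: t := by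
  cases w with
  | nil => exact ⟨[], rfl⟩
  | cons c w =>
    by_cases h : c = x
    · subst h
      exact ⟨_, muExt_cons_self _ _⟩
    · exact ⟨_, muExt_cons_of_ne h _⟩

theorem muExt_injective (x : Bool) : Function.Injective (muExt x) := by
  intro u
  induction u with
  | nil =>
    intro v h
    cases v with
    | nil => rfl
    | cons d v => exact absurd h.symm (muExt_cons_ne_singleton x d v)
  | cons c u ih =>
    intro v h
    cases v with
    | nil => exact absurd h (muExt_cons_ne_singleton x c u)
    | cons d v =>
      obtain ⟨s, hs⟩ := muExt_head x u
      obtain ⟨t, ht⟩ := muExt_head x v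
      by_cases hc : c = x <;> by_cases hd : d = x
      · subst hc hd
        simp only [muExt_cons_self, List.cons.injEq, true_and] at h
        rw [ih h]
      · subst hc
        rw [muExt_cons_self, muExt_cons_of_ne hd, hs] at h
        simp only [List.cons.injEq, true_and] at h
        exact absurd h.1.symm hd
      · subst hd
        rw [muExt_cons_self, muExt_cons_of_ne hc, ht] at h
        simp only [List.cons.injEq, true_and] at h
        exact absurd h.1 hc
      · rw [muExt_cons_of_ne hc, muExt_cons_of_ne hd] at h
        simp only [List.cons.injEq, true_and] at h
        rw [h.1, ih h.2]

theorem muExt_palindrome_iff (x : Bool) (w : List Bool) :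
    (muExt x w).reverse = muExt x w ↔ w.reverse = w := by
  rw [muExt_reverse, (muExt_injective x).eq_iff]

/-! ### Palindromic closure commutes with `muExt x` -/

theorem palClosure_muExt (x : Bool) (w : List Bool) :
    palClosure (muExt x w) = muExt x (palClosure w) := by
  induction w with
  | nil => rw [palClosure_of_palindrome (w := []) rfl, palClosure_of_palindrome (by simp [muExt])]
  | cons c w ih =>
    by_cases hp : (c :: w).reverse = c :: w
    · rw [palClosure_of_palindrome hp,
        palClosure_of_palindrome ((muExt_palindrome_iff x _).2 hp)]
    · have hp' := mt (muExt_palindrome_iff x _).1 hp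
      rw [palClosure_cons_of_not_palindrome hp]
      by_cases h : c = x
      · subst h
        rw [muExt_cons_self] at hp'
        rw [muExt_cons_self, palClosure_cons_of_not_palindrome hp', ih, muExt_cons_self,
          muExt_append_self]
      · rw [muExt_cons_of_ne h] at hp'
        have hq : (c :: muExt x w).reverse ≠ c :: muExt x w :=
          cons_append_singleton_not_palindrome h _
        rw [muExt_cons_of_ne h, palClosure_cons_of_not_palindrome hp',
          palClosure_cons_of_not_palindrome hq, ih, muExt_cons_of_ne h, muExt_append_of_ne h]
        simp

theorem palClosure_muExt_append_of_ne {x y : Bool} (h : y ≠ x) (u : List Bool) :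
    palClosure (muExt x u ++ [y]) = muExt x (palClosure (u ++ [y])) := by
  induction u with
  | nil =>
    rw [show muExt x [] ++ [y] = x :: ([] ++ [y]) from rfl,
      palClosure_cons_of_not_palindrome (cons_append_singleton_not_palindrome h.symm _),
      palClosure_of_palindrome (by simp), List.nil_append, muExt_cons_of_ne h]
    simp [muExt]
  | cons c u ih =>
    by_cases hc : c = x
    · subst hc
      rw [muExt_cons_self, List.cons_append, List.cons_append,
        palClosure_cons_of_not_palindrome (cons_append_singleton_not_palindrome h.symm _),
        palClosure_cons_of_not_palindrome (cons_append_singleton_not_palindrome h.symm _),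
        ih, muExt_cons_self, muExt_append_self]
    · obtain rfl : c = y := by
        revert hc h
        cases c <;> cases x <;> cases y <;> simp
      have hT : muExt x (c :: (u ++ [c])) = x :: ((c :: (muExt x u ++ [c])) ++ [x]) := by
        rw [muExt_cons_of_ne h, muExt_append_of_ne h]
        simp
      have hiff : (c :: (muExt x u ++ [c])).reverse = c :: (muExt x u ++ [c]) ↔
          (c :: (u ++ [c])).reverse = c :: (u ++ [c]) := by
        rw [← muExt_palindrome_iff x (c :: (u ++ [c])), hT]
        simp
      rw [muExt_cons_of_ne h, List.cons_append, List.cons_append, List.cons_append,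
        ← List.cons_append (a := c),
        palClosure_cons_of_not_palindrome (cons_append_singleton_not_palindrome h.symm _),
        List.cons_append]
      by_cases hp : (c :: (u ++ [c])).reverse = c :: (u ++ [c])
      · rw [palClosure_of_palindrome hp, palClosure_of_palindrome (hiff.2 hp), hT]
      · rw [palClosure_cons_of_not_palindrome hp,
          palClosure_cons_of_not_palindrome (mt hiff.1 hp), ih, muExt_cons_of_ne h,
          muExt_append_of_ne h]
        simp

theorem palClosure_muExt_append (x y : Bool) (u : List Bool) :
    palClosure (muExt x u ++ [y]) = muExt x (palClosure (u ++ [y])) := by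
  by_cases h : y = x
  · subst h
    rw [← muExt_append_self, palClosure_muExt]
  · exact palClosure_muExt_append_of_ne h u

/-- Justin's formula `ψ(xv) = μ_x(ψ(v)) x`. -/
theorem psi_cons (x : Bool) (v : List Bool) : psi (x :: v) = muExt x (psi v) := by
  induction v using List.reverseRecOn with
  | nil => exact palClosure_of_palindrome (w := [x]) rfl
  | append_singleton v y ih =>
    have hstep : ∀ u, psi (u ++ [y]) = palClosure (psi u ++ [y]) := fun u => by simp [psi]
    rw [← List.cons_append, hstep, ih, hstep, palClosure_muExt_append]

/-! ### Christoffel words -/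

theorem lamL_false : lamL false = muL false := by
  rw [lamL, muL]
  congr 1
  funext y
  cases y <;> rfl

theorem cons_lamL_true (u : List Bool) : true :: lamL true u = muExt true u := by
  induction u with
  | nil => rfl
  | cons c u ih =>
    cases c
    · rw [muExt_cons_of_ne (by simp), ← ih]
      simp [lamL, applyM]
    · rw [muExt_cons_self, ← ih]
      simp [lamL, applyM]

theorem lamL_christoffel (x : Bool) (u : List Bool) :
    lamL x (false :: (u ++ [true])) = false :: (muExt x u ++ [true]) := by
  cases x
  · rw [lamL_false]
    simp [muExt, muL, applyM]
  · rw [← cons_lamL_true]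
    simp [lamL, applyM]

/-- a·ψ(wv)·b = λ_w(a·ψ(v)·b). -/
theorem christoffel_lamW (w v : List Bool) :
    false :: (psi (w ++ v) ++ [true]) = lamW w (false :: (psi v ++ [true])) := by
  induction w with
  | nil => rfl
  | cons x w ih => rw [lamW, ← ih, lamL_christoffel, List.cons_append, psi_cons]

end Chri
end
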